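/- arXiv:2403.12268 — 5 statements merged into one kernel-verified Lean document; each statement's English description precedes it below -/
import Mathlib

section
/- Let R, Â ∈ Matrix (Fin N) (Fin N) ℂ with R Hermitian and Â Hermitian and invertible, and consider the error functional ε(Â, P) = tr( P • (P•1 + Â⁻¹)⁻¹ * (P•1 + Â⁻¹)⁻¹ * (P•R + 1) − (2P) • R * (P•1 + Â⁻¹)⁻¹ + R ), defined for real P > 0 such that P•1 + Â⁻¹ is invertible (which holds for all sufficiently large P). Then ε(Â, P) tends to 0 as P → +∞, regardless of the choice of Â. -/
open Matrix Filter

theorem Matrix.tendsto_nonsing_inv {n ι 𝕜 : Type*} [Fintype n] [DecidableEq n]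
    [NormedField 𝕜] {l : Filter ι} {f : ι → Matrix n n 𝕜} {M : Matrix n n 𝕜}
    (hf : Tendsto f l (nhds M)) (hM : M.det ≠ 0) :
    Tendsto (fun i => (f i)⁻¹) l (nhds M⁻¹) := by
  simp only [Matrix.inv_def, Ring.inverse_eq_inv']
  exact ((((continuous_id.matrix_det).tendsto M).comp hf).inv₀ hM).smul
    (((continuous_id.matrix_adjugate).tendsto M).comp hf)

theorem Matrix.tendsto_add_inv_smul {n : Type*} (C B : Matrix n n ℂ) :
    Tendsto (fun P : ℝ => C + (P : ℂ)⁻¹ • B) atTop (nhds C) := by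
  have h : Tendsto (fun P : ℝ => (P : ℂ)⁻¹) atTop (nhds 0) := by
    simpa [Function.comp_def] using
      (Complex.continuous_ofReal.tendsto 0).comp tendsto_inv_atTop_zero
  simpa using (h.smul_const B).const_add C

theorem Matrix.smul_one_add_eq_smul {n : Type*} [DecidableEq n] (B : Matrix n n ℂ)
    {c : ℂ} (hc : c ≠ 0) : c • 1 + B = c • (1 + c⁻¹ • B) := by
  rw [smul_add, smul_inv_smul₀ hc]

/-- The mismatched-MMSE error functional
`ε(Â, P) = tr( P • (P•1 + Â⁻¹)⁻¹ * (P•1 + Â⁻¹)⁻¹ * (P•R + 1) − (2P) • R * (P•1 + Â⁻¹)⁻¹ + R )`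
tends to `0` as `P → +∞`, regardless of the choice of `Â`; moreover `P•1 + Â⁻¹` is
invertible for all sufficiently large `P`. -/
theorem statement_4
    {N : ℕ} (R A : Matrix (Fin N) (Fin N) ℂ)
    (hR : R.IsHermitian) (hA : A.IsHermitian) (hAunit : IsUnit A) :
    (∀ᶠ P : ℝ in atTop,
      IsUnit ((P : ℂ) • (1 : Matrix (Fin N) (Fin N) ℂ) + A⁻¹)) ∧
    Tendsto (fun P : ℝ =>
        Matrix.trace ((P : ℂ) •
            (((P : ℂ) • 1 + A⁻¹)⁻¹ * ((P : ℂ) • 1 + A⁻¹)⁻¹ * ((P : ℂ) • R + 1))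
          - (2 * (P : ℂ)) • (R * ((P : ℂ) • 1 + A⁻¹)⁻¹) + R))
      atTop (nhds 0) := by
  set B := A⁻¹
  have hK := Matrix.tendsto_add_inv_smul 1 B
  have hdet : ∀ᶠ P : ℝ in atTop, (1 + (P : ℂ)⁻¹ • B).det ≠ 0 :=
    (((continuous_id.matrix_det).tendsto _).comp hK).eventually_ne (by simp)
  have hpos : ∀ᶠ P : ℝ in atTop, (P : ℂ) ≠ 0 :=
    (eventually_ne_atTop 0).mono fun P hP => Complex.ofReal_ne_zero.mpr hP
  constructor
  · filter_upwards [hdet, hpos] with P hP hP0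
    rw [Matrix.smul_one_add_eq_smul B hP0, Matrix.isUnit_iff_isUnit_det, Matrix.det_smul]
    exact (mul_ne_zero (pow_ne_zero _ hP0) hP).isUnit
  · have hKinv := Matrix.tendsto_nonsing_inv hK (by simp)
    rw [inv_one] at hKinv
    have hR1 : Tendsto (fun P : ℝ => R + (P : ℂ)⁻¹ • (1 : Matrix (Fin N) (Fin N) ℂ))
        atTop (nhds R) := Matrix.tendsto_add_inv_smul R 1
    have hlim := ((((hKinv.mul hKinv).mul hR1).sub
      ((hKinv.const_mul R).const_smul (2 : ℂ))).add_const R)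
    have htr := ((continuous_id.matrix_trace).tendsto _).comp hlim
    have hzero : (1 * 1 * R - (2 : ℂ) • (R * 1) + R) = 0 := by
      rw [two_smul, one_mul, one_mul, mul_one]
      abel
    rw [hzero] at htr
    simp only [id, Matrix.trace_zero] at htr
    refine htr.congr' ?_
    filter_upwards [hdet, hpos] with P hP hP0
    have hinv : ((P : ℂ) • 1 + B)⁻¹ = (P : ℂ)⁻¹ • (1 + (P : ℂ)⁻¹ • B)⁻¹ := by
      rw [Matrix.smul_one_add_eq_smul B hP0]
      exact Matrix.inv_smul' _ (Units.mk0 _ hP0) hP.isUnit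
    have hRP : (P : ℂ) • R + 1 = (P : ℂ) • (R + (P : ℂ)⁻¹ • 1) := by
      rw [smul_add, smul_inv_smul₀ hP0]
    rw [hinv, hRP]
    simp only [Function.comp_apply, Matrix.smul_mul, Matrix.mul_smul, smul_smul]
    congr 4
    · field_simp
      simp
    · field_simp
end

section
/- Let R ∈ Matrix (Fin N) (Fin N) ℂ be Hermitian positive semidefinite and let P > 0 be real, so that P•R + 1 is invertible. Define F(M) = Re tr( M * (P•R + 1) * Mᴴ − √P • M * R − √P • R * Mᴴ + R ) for M ∈ Matrix (Fin N) (Fin N) ℂ. Then for every M, F(M) ≥ F(M₀) where M₀ = √P • R * (P•R + 1)⁻¹; i.e., the linear MMSE estimator matrix M₀ minimizes the mean squared error functional F. -/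
open Matrix
open scoped ComplexOrder

/-- If `M₀ * A = B`, with `A` positive semidefinite and `B` Hermitian, then the quadratic trace
functional `M ↦ Re tr (M * A * Mᴴ - M * B - B * Mᴴ + C)` attains its minimum at `M₀`. -/
theorem re_trace_quadratic_le {n : Type*} [Fintype n] {A B M₀ : Matrix n n ℂ}
    (hA : A.PosSemidef) (hB : B.IsHermitian) (h : M₀ * A = B) (C M : Matrix n n ℂ) :
    (trace (M₀ * A * M₀ᴴ - M₀ * B - B * M₀ᴴ + C)).re ≤
      (trace (M * A * Mᴴ - M * B - B * Mᴴ + C)).re := by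
  have h' : A * M₀ᴴ = B := by
    simpa [hA.isHermitian.eq, hB.eq] using congrArg conjTranspose h
  have key : M * A * Mᴴ - M * B - B * Mᴴ + C =
      (M₀ * A * M₀ᴴ - M₀ * B - B * M₀ᴴ + C) + (M - M₀) * A * (M - M₀)ᴴ := by
    simp only [conjTranspose_sub, sub_mul, mul_sub, h, Matrix.mul_assoc M A M₀ᴴ, h']
    have h₀ : B * M₀ᴴ = M₀ * B := by rw [← h, Matrix.mul_assoc, h', h]
    rw [h₀]
    abel
  rw [key, trace_add _ ((M - M₀) * A * (M - M₀)ᴴ), Complex.add_re]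
  exact le_add_of_nonneg_right
    (Complex.le_def.mp (hA.mul_mul_conjTranspose_same (M - M₀)).trace_nonneg).1

/-- The linear MMSE estimator matrix `M₀ = √P • R * (P•R + 1)⁻¹` minimizes
the mean squared error functional
`F(M) = Re tr( M * (P•R + 1) * Mᴴ − √P • M * R − √P • R * Mᴴ + R )`. -/
theorem statement_5
    {N : ℕ} (R : Matrix (Fin N) (Fin N) ℂ)
    (hR : R.PosSemidef) (P : ℝ) (hP : 0 < P)
    (F : Matrix (Fin N) (Fin N) ℂ → ℝ)
    (hF : F = fun M =>
      (Matrix.trace (M * ((P : ℂ) • R + 1) * Mᴴ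
        - (Real.sqrt P : ℂ) • (M * R) - (Real.sqrt P : ℂ) • (R * Mᴴ) + R)).re) :
    ∀ M : Matrix (Fin N) (Fin N) ℂ,
      F ((Real.sqrt P : ℂ) • (R * ((P : ℂ) • R + 1)⁻¹)) ≤ F M := by
  intro M
  have hA : ((P : ℂ) • R + 1).PosDef :=
    PosDef.posSemidef_add (hR.smul (Complex.zero_le_real.mpr hP.le)) PosDef.one
  have hB : ((Real.sqrt P : ℂ) • R).IsHermitian :=
    (hR.smul (Complex.zero_le_real.mpr (Real.sqrt_nonneg P))).isHermitian
  have h : (Real.sqrt P : ℂ) • (R * ((P : ℂ) • R + 1)⁻¹) * ((P : ℂ) • R + 1) =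
      (Real.sqrt P : ℂ) • R := by
    rw [smul_mul_assoc, nonsing_inv_mul_cancel_right _ _
      ((isUnit_iff_isUnit_det _).mp hA.isUnit)]
  have key := re_trace_quadratic_le hA.posSemidef hB h R M
  subst hF
  simpa only [smul_mul_assoc, mul_smul_comm] using key
end

section
/- Let R, Â ∈ Matrix (Fin N) (Fin N) ℂ with R Hermitian positive semidefinite and invertible, Â Hermitian and invertible, and let P > 0 be real such that P•Â + 1 and P•R + 1 are invertible. With the error functional ε(Â, P) = tr( P • (P•1 + Â⁻¹)⁻¹ * (P•1 + Â⁻¹)⁻¹ * (P•R + 1) − (2P) • R * (P•1 + Â⁻¹)⁻¹ + R ), one has Re ε(Â, P) ≥ Re ε(R, P); i.e., among all such approximate correlation matrices Â the error is minimized when Â equals the true correlation matrix R. -/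
open Matrix
open scoped ComplexOrder

/-- The inverse of `c • 1 + R⁻¹` is the Wiener filter `R (c • R + 1)⁻¹`, stated without division:
it gives `R` when multiplied by `c • R + 1` on either side. -/
theorem smul_one_add_inv_inv_mul {n K : Type*} [Fintype n] [DecidableEq n] [Field K]
    {R : Matrix n n K} {c : K} (hR : IsUnit R) (hcR : IsUnit (c • R + 1)) :
    (c • (1 : Matrix n n K) + R⁻¹)⁻¹ * (c • R + 1) = R ∧
      (c • R + 1) * (c • (1 : Matrix n n K) + R⁻¹)⁻¹ = R := by
  have hdet := (isUnit_iff_isUnit_det R).1 hR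
  have hleft : (c • (1 : Matrix n n K) + R⁻¹) * R = c • R + 1 := by
    rw [add_mul, nonsing_inv_mul R hdet, smul_mul_assoc, one_mul]
  have hright : R * (c • (1 : Matrix n n K) + R⁻¹) = c • R + 1 := by
    rw [mul_add, mul_nonsing_inv R hdet, mul_smul_comm, mul_one]
  have hunit : IsUnit (c • (1 : Matrix n n K) + R⁻¹).det := by
    rw [isUnit_iff_isUnit_det, ← hleft, det_mul] at hcR
    exact isUnit_of_mul_isUnit_left hcR
  constructor
  · rw [← hleft, nonsing_inv_mul_cancel_left _ _ hunit]
  · rw [← hright, mul_nonsing_inv_cancel_right _ _ hunit]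

/-- Completing the square for the quadratic `B ↦ tr (B B M) - 2 tr (R B)` around a `B₀` with
`B₀ M = M B₀ = R`. -/
theorem trace_sub_mul_sub_mul {n K : Type*} [Fintype n] [CommRing K]
    {R M B B₀ : Matrix n n K} (hl : B₀ * M = R) (hr : M * B₀ = R) :
    trace ((B - B₀) * (B - B₀) * M) =
      (trace (B * B * M) - 2 * trace (R * B)) - (trace (B₀ * B₀ * M) - 2 * trace (R * B₀)) := by
  have h₁ : trace (B * B₀ * M) = trace (R * B) := by
    rw [mul_assoc, hl, trace_mul_comm]
  have h₂ : trace (B₀ * B * M) = trace (R * B) := by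
    rw [mul_assoc, trace_mul_comm, mul_assoc, hr, trace_mul_comm]
  have h₃ : trace (B₀ * B₀ * M) = trace (R * B₀) := by
    rw [mul_assoc, hl, trace_mul_comm]
  simp only [sub_mul, mul_sub, trace_sub, h₁, h₂, h₃]
  ring

/-- `tr (D D M) ≥ 0` for Hermitian `D` and positive semidefinite `M`. -/
theorem trace_mul_self_mul_nonneg {n : Type*} [Fintype n]
    {D M : Matrix n n ℂ} (hD : D.IsHermitian) (hM : M.PosSemidef) :
    0 ≤ trace (D * D * M) := by
  have h := (hM.mul_mul_conjTranspose_same D).trace_nonneg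
  rwa [hD.eq, trace_mul_comm, ← mul_assoc] at h

/-- Among approximate correlation matrices `Â`, the mismatched-MMSE error
`ε(Â, P) = tr( P • (P•1 + Â⁻¹)⁻¹ * (P•1 + Â⁻¹)⁻¹ * (P•R + 1) − (2P) • R * (P•1 + Â⁻¹)⁻¹ + R )`
is minimized (in real part) at `Â = R`. -/
theorem statement_6
    {N : ℕ} (R A : Matrix (Fin N) (Fin N) ℂ)
    (hRpsd : R.PosSemidef) (hRunit : IsUnit R)
    (hAherm : A.IsHermitian) (hAunit : IsUnit A)
    (P : ℝ) (hP : 0 < P)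
    (hPA : IsUnit ((P : ℂ) • A + 1)) (hPR : IsUnit ((P : ℂ) • R + 1))
    (eps : Matrix (Fin N) (Fin N) ℂ → ℂ)
    (heps : eps = fun X =>
      Matrix.trace ((P : ℂ) •
          (((P : ℂ) • 1 + X⁻¹)⁻¹ * ((P : ℂ) • 1 + X⁻¹)⁻¹ * ((P : ℂ) • R + 1))
        - (2 * (P : ℂ)) • (R * ((P : ℂ) • 1 + X⁻¹)⁻¹) + R)) :
    (eps R).re ≤ (eps A).re := by
  subst heps
  have hPc : (0 : ℂ) ≤ P := by exact_mod_cast hP.le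
  have hfilter : ∀ {X : Matrix (Fin N) (Fin N) ℂ}, X.IsHermitian →
      (((P : ℂ) • (1 : Matrix (Fin N) (Fin N) ℂ) + X⁻¹)⁻¹).IsHermitian := fun hX =>
    ((PosSemidef.one.smul hPc).isHermitian.add hX.inv).inv
  obtain ⟨hl, hr⟩ := smul_one_add_inv_inv_mul hRunit hPR
  have hsq := trace_sub_mul_sub_mul
    (B := ((P : ℂ) • (1 : Matrix (Fin N) (Fin N) ℂ) + A⁻¹)⁻¹) hl hr
  have hnonneg := mul_nonneg hPc (trace_mul_self_mul_nonneg
    ((hfilter hAherm).sub (hfilter hRpsd.isHermitian))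
    ((hRpsd.smul hPc).add PosSemidef.one))
  rw [hsq] at hnonneg
  have hre := (Complex.le_def.1 hnonneg).1
  rw [← sub_nonneg, ← Complex.sub_re]
  refine hre.trans_eq (congrArg Complex.re ?_)
  simp only [trace_add, trace_sub, trace_smul, smul_eq_mul]
  ring
end

section
/- For every r_s > 0 and every real a > −1, the scatterer gain density f_{r_s,a} is Lebesgue integrable on ℝ² and ∫_{ℝ²} f_{r_s,a}(x) dx = 1. -/
open MeasureTheory

/-- The scatterer gain density on ℝ²: for radius `rs > 0` and concentration `a > −1`,
`f(x) = ((a+1)/(π·rs^{2a+2}))·(rs² − ‖x‖²)^a` for `‖x‖ < rs`, and `0` otherwise. -/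
noncomputable def scattererGain (rs a : ℝ) (x : EuclideanSpace ℝ (Fin 2)) : ℝ :=
  if ‖x‖ < rs then ((a + 1) / (Real.pi * rs ^ (2 * a + 2))) * (rs ^ 2 - ‖x‖ ^ 2) ^ a
  else 0

/-- The profile `y ↦ y (r² - y²)^a` is integrable on `(0, r)`, with integral `r^(2a+2) / (2(a+1))`. -/
theorem integrableOn_and_integral_mul_sq_sub_sq_rpow {r a : ℝ} (hr : 0 < r) (ha : -1 < a) :
    IntegrableOn (fun y : ℝ ↦ y * (r ^ 2 - y ^ 2) ^ a) (Set.Ioo 0 r) ∧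
      ∫ y in Set.Ioo 0 r, y * (r ^ 2 - y ^ 2) ^ a = r ^ (2 * a + 2) / (2 * (a + 1)) := by
  have ha' : 0 < a + 1 := by linarith
  have hcont : ContinuousOn (fun y : ℝ ↦ -(r ^ 2 - y ^ 2) ^ (a + 1) / (2 * (a + 1)))
      (Set.Icc 0 r) := by
    have h : Continuous fun y : ℝ ↦ (r ^ 2 - y ^ 2) ^ (a + 1) :=
      (by fun_prop : Continuous fun y : ℝ ↦ r ^ 2 - y ^ 2).rpow_const fun _ ↦ .inr ha'.le
    exact (h.neg.div_const _).continuousOn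
  have hpos : ∀ y ∈ Set.Ioo 0 r, 0 < r ^ 2 - y ^ 2 := fun y hy ↦ by
    nlinarith [hy.1, hy.2]
  have hderiv : ∀ y ∈ Set.Ioo 0 r,
      HasDerivAt (fun y : ℝ ↦ -(r ^ 2 - y ^ 2) ^ (a + 1) / (2 * (a + 1)))
        (y * (r ^ 2 - y ^ 2) ^ a) y := fun y hy ↦ by
    have h := ((((hasDerivAt_pow 2 y).const_sub (r ^ 2)).rpow_const (p := a + 1)
      (.inl (hpos y hy).ne')).neg).div_const (2 * (a + 1))
    refine h.congr_deriv ?_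
    rw [add_sub_cancel_right]
    field_simp
    push_cast
    ring
  have hint := intervalIntegral.integrableOn_deriv_of_nonneg hcont hderiv fun y hy ↦
    mul_nonneg hy.1.le (Real.rpow_nonneg (hpos y hy).le a)
  refine ⟨hint.mono_set Set.Ioo_subset_Ioc_self, ?_⟩
  rw [← integral_Ioc_eq_integral_Ioo, ← intervalIntegral.integral_of_le hr.le,
    intervalIntegral.integral_eq_sub_of_hasDerivAt_of_le hr.le hcont hderiv
      ((intervalIntegrable_iff_integrableOn_Ioc_of_le hr.le).2 hint)]
  have hpow : (r ^ 2) ^ (a + 1) = r ^ (2 * a + 2) := by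
    rw [← Real.rpow_natCast, ← Real.rpow_mul hr.le]
    congr 1
    push_cast
    ring
  simp only [sub_self, Real.zero_rpow ha'.ne', ne_eq, OfNat.ofNat_ne_zero, not_false_eq_true,
    zero_pow, sub_zero, hpow]
  ring

/-- For every `rs > 0` and `a > −1`, the scatterer gain density is
Lebesgue integrable on ℝ² and integrates to `1`. -/
theorem statement_10 (rs a : ℝ) (hrs : 0 < rs) (ha : -1 < a) :
    Integrable (scattererGain rs a) (volume : Measure (EuclideanSpace ℝ (Fin 2))) ∧
      (∫ x, scattererGain rs a x) = 1 := by
  obtain ⟨hint, hval⟩ := integrableOn_and_integral_mul_sq_sub_sq_rpow hrs ha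
  set c : ℝ := (a + 1) / (Real.pi * rs ^ (2 * a + 2)) with hc
  let f : ℝ → ℝ := (Set.Iio rs).indicator fun y ↦ c * (rs ^ 2 - y ^ 2) ^ a
  have hf : scattererGain rs a = fun x ↦ f ‖x‖ := by
    ext x
    simp [scattererGain, f, Set.indicator_apply, hc]
  have hprofile : (fun y : ℝ ↦ y ^ (Module.finrank ℝ (EuclideanSpace ℝ (Fin 2)) - 1) • f y) =
      (Set.Iio rs).indicator fun y ↦ c * (y * (rs ^ 2 - y ^ 2) ^ a) := by
    ext y
    by_cases hy : y < rs
    · simp [f, hy]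
      ring
    · simp [f, hy]
  have hset : Set.Ioi (0 : ℝ) ∩ Set.Iio rs = Set.Ioo 0 rs := Set.Ioi_inter_Iio
  rw [hf]
  constructor
  · rw [integrable_fun_norm_addHaar, hprofile, IntegrableOn, integrable_indicator_iff
      measurableSet_Iio, IntegrableOn, Measure.restrict_restrict measurableSet_Iio,
      Set.inter_comm, hset]
    exact hint.const_mul c
  · have hball : (volume : Measure (EuclideanSpace ℝ (Fin 2))).real (Metric.ball 0 1) =
        Real.pi := by
      simp [measureReal_def, Real.pi_pos.le]
    have hrpow : 0 < rs ^ (2 * a + 2) := Real.rpow_pos_of_pos hrs _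
    have ha' : a + 1 ≠ 0 := by linarith
    rw [integral_fun_norm_addHaar, hprofile, setIntegral_indicator measurableSet_Iio, hset,
      integral_const_mul, hval, hball, hc]
    simp only [finrank_euclideanSpace, Fintype.card_fin, nsmul_eq_mul, smul_eq_mul]
    field_simp
    simp
end

section
/- (Extension of the Rayleigh distance criterion, near-field part of Lemma 2.) Let V be a real inner product space, let u ∈ V with ‖u‖ = 1, let D > 0, r_s ≥ 0, r_m ≥ 0, and let λ be a real number with λ > 16·r_s and D ≥ 8·(r_s + r_m)² / (λ − 16·r_s). Then for all ρ, r ∈ V with ‖ρ‖ ≤ r_s and ‖r‖ ≤ r_m, the phase-error term satisfies (2π/λ) · | ⟨u, ρ⟩ + ‖ρ‖²/(2D) + ‖r‖²/(2D) − ⟨ρ, r⟩/D − ⟨u, ρ⟩²/(2D) − ⟨u, r⟩²/(2D) + ⟨u, ρ⟩·⟨u, r⟩/D | ≤ π/8. -/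
open scoped RealInnerProductSpace

/-- near-field part of Lemma 2: if `λ > 16·r_s` and
`D ≥ 8·(r_s + r_m)²/(λ − 16·r_s)`, then the first- and second-order phase-error term
is at most `π/8` for all points `ρ` on the scatterer and `r` on the array. -/
theorem statement_13
    {V : Type*} [NormedAddCommGroup V] [InnerProductSpace ℝ V]
    (u : V) (hu : ‖u‖ = 1) (D rs rm lam : ℝ)
    (hD : 0 < D) (hrs : 0 ≤ rs) (hrm : 0 ≤ rm)
    (hlam : 16 * rs < lam)
    (hDbound : 8 * (rs + rm) ^ 2 / (lam - 16 * rs) ≤ D) :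
    ∀ ρ r : V, ‖ρ‖ ≤ rs → ‖r‖ ≤ rm →
      (2 * Real.pi / lam) *
          |⟪u, ρ⟫ + ‖ρ‖ ^ 2 / (2 * D) + ‖r‖ ^ 2 / (2 * D) - ⟪ρ, r⟫ / D
            - ⟪u, ρ⟫ ^ 2 / (2 * D) - ⟪u, r⟫ ^ 2 / (2 * D) + ⟪u, ρ⟫ * ⟪u, r⟫ / D| ≤
        Real.pi / 8 := by
  intro ρ r hρ hr
  have hlam0 : 0 < lam := by linarith
  have hgap : 0 < lam - 16 * rs := by linarith
  have hinner (x : V) : |⟪u, x⟫| ≤ ‖x‖ := by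
    simpa [hu] using abs_real_inner_le_norm u x
  have hexpand : ⟪u, ρ⟫ + ‖ρ‖ ^ 2 / (2 * D) + ‖r‖ ^ 2 / (2 * D) - ⟪ρ, r⟫ / D
      - ⟪u, ρ⟫ ^ 2 / (2 * D) - ⟪u, r⟫ ^ 2 / (2 * D) + ⟪u, ρ⟫ * ⟪u, r⟫ / D
      = ⟪u, ρ⟫ + (‖ρ - r‖ ^ 2 - ⟪u, ρ - r⟫ ^ 2) / (2 * D) := by
    rw [norm_sub_sq_real, inner_sub_right]
    field_simp
    ring
  have hsq : ⟪u, ρ - r⟫ ^ 2 ≤ ‖ρ - r‖ ^ 2 :=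
    sq_le_sq.mpr (by simpa using hinner (ρ - r))
  have hnorm : ‖ρ - r‖ ^ 2 ≤ (rs + rm) ^ 2 :=
    pow_le_pow_left₀ (norm_nonneg _) ((norm_sub_le ρ r).trans (add_le_add hρ hr)) 2
  have hnonneg : 0 ≤ (‖ρ - r‖ ^ 2 - ⟪u, ρ - r⟫ ^ 2) / (2 * D) :=
    div_nonneg (sub_nonneg.mpr hsq) (by positivity)
  have hquad : (‖ρ - r‖ ^ 2 - ⟪u, ρ - r⟫ ^ 2) / (2 * D) ≤ (lam - 16 * rs) / 16 := by
    rw [div_le_iff₀ hgap] at hDbound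
    rw [div_le_iff₀ (by positivity)]
    nlinarith [sq_nonneg ⟪u, ρ - r⟫]
  have hlin := abs_le.mp ((hinner ρ).trans hρ)
  rw [hexpand]
  calc
    _ ≤ (2 * Real.pi / lam) * (lam / 16) := by
      gcongr
      exact abs_le.mpr ⟨by linarith, by linarith⟩
    _ = Real.pi / 8 := by
      field_simp
      norm_num
end
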